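/- arXiv:0912.1922 — 2 statements merged into one kernel-verified Lean document; each statement's English description precedes it below -/
import Mathlib

section
/- Let F be a finite field of order q, and let L be the image of SL_2(F) under the natural homomorphism SL_2(F) → PGL_2(F) (so L ≅ PSL_2(q)). Suppose H is a subgroup of L such that either gcd(q, 6) = 1 and H is isomorphic to the symmetric group Sym_4, or gcd(q, 30) = 1 and H is isomorphic to SL_2(4) (equivalently, to the alternating group Alt_5). Then there is no subgroup H₁ of PGL_2(F) with H₁ ∩ L = H and |H₁| = 2·|H|. -/
/-- The natural homomorphism `SL₂(F) → PGL₂(F)`, whose range is (isomorphic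
to) `PSL₂(q)`. -/
noncomputable def SLtoPGL (F : Type*) [Field F] :
    Matrix.SpecialLinearGroup (Fin 2) F →*
      (Matrix.GeneralLinearGroup (Fin 2) F ⧸
        Subgroup.center (Matrix.GeneralLinearGroup (Fin 2) F)) :=
  (QuotientGroup.mk' _).comp Matrix.SpecialLinearGroup.toGL

namespace PGLAux

open Matrix

/-- The projective general linear group of rank 2. -/
abbrev P (F : Type*) [Field F] :=
  Matrix.GeneralLinearGroup (Fin 2) F ⧸ Subgroup.center (Matrix.GeneralLinearGroup (Fin 2) F)

/-! ### Finite computations in `Sym₄` and `Alt₅` -/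

/-- first double transposition in `Sym₄` -/
def a4 : Equiv.Perm (Fin 4) := Equiv.swap 0 1 * Equiv.swap 2 3
/-- second double transposition in `Sym₄` -/
def b4 : Equiv.Perm (Fin 4) := Equiv.swap 0 2 * Equiv.swap 1 3

lemma s4_step1 : ∀ s : Equiv.Perm (Fin 4), (s ^ 2) ^ 2 = 1 → s ^ 2 ≠ 1 →
    ∃ h : Equiv.Perm (Fin 4), h * a4 * h⁻¹ = s ^ 2 := by decide +kernel

lemma s4_step2 : ∀ s : Equiv.Perm (Fin 4), (s ^ 2) ^ 2 = 1 → s ^ 2 ≠ 1 → s ^ 2 ≠ a4 →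
    ∃ h : Equiv.Perm (Fin 4), h * a4 * h⁻¹ = a4 ∧ h * b4 * h⁻¹ = s ^ 2 := by decide +kernel

lemma s4_sq : (∃ s : Equiv.Perm (Fin 4), s ^ 2 = a4) ∧ ∃ s : Equiv.Perm (Fin 4), s ^ 2 = b4 := by
  decide +kernel

/-- double transposition in `Alt₅` -/
def a5 : alternatingGroup (Fin 5) := ⟨Equiv.swap 0 1 * Equiv.swap 2 3, by rw [Equiv.Perm.mem_alternatingGroup]; decide⟩
/-- a 5-cycle in `Alt₅` -/
def c5 : alternatingGroup (Fin 5) := ⟨finRotate 5, by rw [Equiv.Perm.mem_alternatingGroup]; decide⟩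

lemma a5_step1 : ∀ c : alternatingGroup (Fin 5), c ^ 5 = 1 → c ≠ 1 →
    ∃ h : alternatingGroup (Fin 5), h * c5 * h⁻¹ = c ∨ h * c5 ^ 2 * h⁻¹ = c := by decide +kernel

lemma a5_step2 : ∀ a : alternatingGroup (Fin 5), a ^ 2 = 1 → a ≠ 1 → (a * c5) ^ 3 = 1 →
    ∃ h : alternatingGroup (Fin 5), h * c5 * h⁻¹ = c5 ∧ h * a5 * h⁻¹ = a := by decide +kernel

/-- second double transposition in `Alt₅`, commuting with the first -/
def b5 : alternatingGroup (Fin 5) := c5 ^ 2 * a5 * c5 ^ 3 * a5 * c5 ^ 2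

lemma a5_facts : a5 ^ 2 = 1 ∧ b5 ^ 2 = 1 ∧ a5 ≠ 1 ∧ b5 ≠ 1 ∧ a5 ≠ b5 ∧ a5 * b5 = b5 * a5 ∧
    c5 ^ 5 = 1 ∧ c5 ≠ 1 ∧ (a5 * c5) ^ 3 = 1 := by decide +kernel

lemma s4_facts : a4 ^ 2 = 1 ∧ b4 ^ 2 = 1 ∧ a4 ≠ 1 ∧ b4 ≠ 1 ∧ a4 ≠ b4 ∧ a4 * b4 = b4 * a4 := by
  decide +kernel

/-! ### Linear algebra -/

section lin
variable {F : Type*} [Field F]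

lemma mk_eq {g h : GL (Fin 2) F} (e : (QuotientGroup.mk g : P F) = QuotientGroup.mk h) :
    ∃ c : F, (h : Matrix (Fin 2) (Fin 2) F) = c • (g : Matrix (Fin 2) (Fin 2) F) := by
  rw [QuotientGroup.eq, GeneralLinearGroup.mem_center_iff_val_mem_range_scalar] at e
  obtain ⟨c, hc⟩ := e
  refine ⟨c, ?_⟩
  have : h = g * (g⁻¹ * h) := by group
  rw [this, Units.val_mul, ← hc]
  simp [← smul_one_eq_diagonal]

lemma mk_eq_one {g : GL (Fin 2) F} {c : F}
    (e : (g : Matrix (Fin 2) (Fin 2) F) = c • (1 : Matrix (Fin 2) (Fin 2) F)) :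
    (QuotientGroup.mk g : P F) = 1 := by
  rw [QuotientGroup.eq_one_iff, GeneralLinearGroup.mem_center_iff_val_mem_range_scalar]
  exact ⟨c, by simp [e, ← smul_one_eq_diagonal]⟩

lemma mk_eq_of_smul {g h : GL (Fin 2) F} {c : F}
    (e : (h : Matrix (Fin 2) (Fin 2) F) = c • (g : Matrix (Fin 2) (Fin 2) F)) :
    (QuotientGroup.mk g : P F) = QuotientGroup.mk h := by
  have : (QuotientGroup.mk (g⁻¹ * h) : P F) = 1 := by
    apply mk_eq_one (c := c)
    rw [Units.val_mul, e, mul_smul_comm, ← Units.val_mul]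
    simp
  rw [QuotientGroup.mk_mul, QuotientGroup.mk_inv, inv_mul_eq_one] at this
  exact this

lemma comm_nonscalar {A X : Matrix (Fin 2) (Fin 2) F} (h : A * X = X * A)
    (hA : ∀ c : F, A ≠ c • 1) : ∃ u v : F, X = u • 1 + v • A := by
  have h00 := congrFun (congrFun h 0) 0
  have h01 := congrFun (congrFun h 0) 1
  have h10 := congrFun (congrFun h 1) 0
  simp only [mul_apply, Fin.sum_univ_two] at h00 h01 h10
  by_cases h1 : A 0 1 = 0
  · by_cases h2 : A 1 0 = 0
    · have h3 : A 0 0 - A 1 1 ≠ 0 := by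
        intro h3
        apply hA (A 0 0)
        ext i j
        fin_cases i <;> fin_cases j <;> simp [h1, h2]
        exact (sub_eq_zero.mp h3).symm
      refine ⟨X 0 0 - (X 0 0 - X 1 1) / (A 0 0 - A 1 1) * A 0 0,
        (X 0 0 - X 1 1) / (A 0 0 - A 1 1), ?_⟩
      have e1 : X 0 1 = 0 := by
        apply mul_left_cancel₀ h3; linear_combination h01 + (X 0 0 - X 1 1) * h1
      have e2 : X 1 0 = 0 := by
        apply mul_left_cancel₀ h3; linear_combination -h10 + (X 0 0 - X 1 1) * h2
      ext i j
      fin_cases i <;> fin_cases j <;> simp [h1, h2, e1, e2]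
      field_simp
      ring
    · refine ⟨X 0 0 - X 1 0 / A 1 0 * A 0 0, X 1 0 / A 1 0, ?_⟩
      ext i j
      fin_cases i <;> fin_cases j <;> simp <;> field_simp <;> grind
  · refine ⟨X 0 0 - X 0 1 / A 0 1 * A 0 0, X 0 1 / A 0 1, ?_⟩
    ext i j
    fin_cases i <;> fin_cases j <;> simp <;> field_simp <;> grind

lemma ch (A : Matrix (Fin 2) (Fin 2) F) : A * A = A.trace • A - A.det • 1 := by
  ext i j
  fin_cases i <;> fin_cases j <;> simp [mul_apply, trace_fin_two, det_fin_two] <;> ring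

lemma tr_zero {A : Matrix (Fin 2) (Fin 2) F} (hA : ∀ c : F, A ≠ c • 1) {s : F}
    (h : A * A = s • 1) : A.trace = 0 := by
  by_contra ht
  rw [ch] at h
  apply hA (A.trace⁻¹ * (s + A.det))
  have : A.trace • A = (s + A.det) • (1 : Matrix (Fin 2) (Fin 2) F) := by
    rw [add_smul, ← h]; abel
  rw [mul_smul, ← this, smul_smul, inv_mul_cancel₀ ht, one_smul]

/-- scalar in a commutation relation is `±1`. -/
lemma comm_sign {A B : GL (Fin 2) F} {c : F}
    (h : (A * B : Matrix (Fin 2) (Fin 2) F) = c • (B * A : Matrix (Fin 2) (Fin 2) F)) :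
    c = 1 ∨ c = -1 := by
  have hd := congrArg det h
  rw [det_smul, det_mul, det_mul] at hd
  have hA : det (A : Matrix (Fin 2) (Fin 2) F) ≠ 0 := A.det.ne_zero
  have hB : det (B : Matrix (Fin 2) (Fin 2) F) ≠ 0 := B.det.ne_zero
  simp only [Fintype.card_fin] at hd
  have : c ^ 2 = 1 := by
    apply mul_right_cancel₀ (mul_ne_zero hA hB); linear_combination -hd
  simpa using this

/-- A Klein four-group in `PGL₂` is self-centralizing. -/
lemma klein (h2 : (2 : F) ≠ 0) {a b x : P F} (ha : a ^ 2 = 1) (hb : b ^ 2 = 1) (ha1 : a ≠ 1)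
    (hb1 : b ≠ 1) (hab : a ≠ b) (hc : a * b = b * a) (hxa : x * a = a * x)
    (hxb : x * b = b * x) : x = 1 ∨ x * a = 1 ∨ x * b = 1 ∨ x * a * b = 1 := by
  induction a using QuotientGroup.induction_on with | H A => ?_
  induction b using QuotientGroup.induction_on with | H B => ?_
  induction x using QuotientGroup.induction_on with | H X => ?_
  have nsA : ∀ c : F, (A : Matrix (Fin 2) (Fin 2) F) ≠ c • 1 := fun c h => ha1 (mk_eq_one h)
  have nsB : ∀ c : F, (B : Matrix (Fin 2) (Fin 2) F) ≠ c • 1 := fun c h => hb1 (mk_eq_one h)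
  obtain ⟨s, hs⟩ := mk_eq (g := 1) (h := A * A) (by rw [QuotientGroup.mk_mul, ← sq, ha]; rfl)
  obtain ⟨r, hr⟩ := mk_eq (g := 1) (h := B * B) (by rw [QuotientGroup.mk_mul, ← sq, hb]; rfl)
  obtain ⟨c, hc⟩ := mk_eq (g := B * A) (h := A * B) (by simpa using hc.symm)
  obtain ⟨d, hd⟩ := mk_eq (g := A * X) (h := X * A) (by simpa using hxa.symm)
  obtain ⟨e, he⟩ := mk_eq (g := B * X) (h := X * B) (by simpa using hxb.symm)
  simp only [Units.val_mul, Units.val_one] at hs hr hc hd he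
  have tA := tr_zero nsA hs
  have tB := tr_zero nsB hr
  have hcm : (A * B : Matrix (Fin 2) (Fin 2) F) = -(B * A : Matrix (Fin 2) (Fin 2) F) := by
    rcases comm_sign hc with rfl | rfl
    · exfalso
      rw [one_smul] at hc
      obtain ⟨u, v, huv⟩ := comm_nonscalar hc nsA
      have ht := congrArg trace huv
      rw [trace_add, trace_smul, trace_smul, tA, tB, trace_one] at ht
      have hu : u = 0 := by
        simp only [Fintype.card_fin, smul_eq_mul, mul_zero, add_zero, Nat.cast_ofNat] at ht
        rcases mul_eq_zero.mp ht.symm with h | h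
        · exact h
        · exact absurd h h2
      rw [hu, zero_smul, zero_add] at huv
      exact hab (mk_eq_of_smul huv)
    · simpa using hc
  -- an element commuting with both is scalar
  have key : ∀ Y : GL (Fin 2) F,
      (Y * A : Matrix (Fin 2) (Fin 2) F) = (A * Y : Matrix (Fin 2) (Fin 2) F) →
      (Y * B : Matrix (Fin 2) (Fin 2) F) = (B * Y : Matrix (Fin 2) (Fin 2) F) →
      (QuotientGroup.mk Y : P F) = 1 := by
    intro Y hYA hYB
    obtain ⟨u, v, huv⟩ := comm_nonscalar hYA.symm nsA
    rw [huv, add_mul, mul_add, smul_mul_assoc, smul_mul_assoc, mul_smul_comm, mul_smul_comm,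
      hcm, mul_one, one_mul, add_right_inj] at hYB
    have hv : (v * 2) • (B * A : Matrix (Fin 2) (Fin 2) F) = 0 := by
      rw [mul_two, add_smul]
      nth_rewrite 1 [← hYB]
      simp
    rw [← Units.val_mul] at hv
    have hv0 : v = 0 := by
      rcases smul_eq_zero.mp hv with h | h
      · exact (mul_eq_zero.mp h).resolve_right h2
      · exact absurd h (B * A).ne_zero
    rw [hv0, zero_smul, add_zero] at huv
    exact mk_eq_one huv
  have hcm' : (B * A : Matrix (Fin 2) (Fin 2) F) = -(A * B : Matrix (Fin 2) (Fin 2) F) := by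
    rw [hcm, neg_neg]
  rcases comm_sign hd with rfl | rfl <;> rcases comm_sign he with rfl | rfl <;>
    simp only [one_smul, neg_smul] at hd he
  · exact Or.inl (key X hd he)
  · refine Or.inr (Or.inl (key (X * A) ?_ ?_)) <;> simp only [Units.val_mul]
    · rw [hd, mul_assoc, hd]
    · rw [mul_assoc, hcm, mul_neg, ← mul_assoc, he, neg_mul, neg_neg, mul_assoc]
  · refine Or.inr (Or.inr (Or.inl (key (X * B) ?_ ?_))) <;> simp only [Units.val_mul]
    · rw [mul_assoc, hcm', mul_neg, ← mul_assoc, hd, neg_mul, neg_neg, mul_assoc]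
    · rw [he, mul_assoc, he]
  · refine Or.inr (Or.inr (Or.inr (key (X * A * B) ?_ ?_))) <;> simp only [Units.val_mul]
    · generalize A.val = A at *
      generalize B.val = B at *
      generalize X.val = X at *
      calc X * A * B * A = X * A * (B * A) := by rw [mul_assoc]
        _ = -(X * A) * (A * B) := by rw [hcm', mul_neg, neg_mul]
        _ = A * X * (A * B) := by rw [hd, neg_neg]
        _ = A * (X * A * B) := by simp only [mul_assoc]
    · generalize A.val = A at *
      generalize B.val = B at *
      generalize X.val = X at *
      calc X * A * B * B = X * (A * B) * B := by simp only [mul_assoc]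
        _ = X * (-(B * A)) * B := by rw [hcm]
        _ = -(X * B) * (A * B) := by simp only [mul_assoc, mul_neg, neg_mul]
        _ = B * X * (A * B) := by rw [he, neg_neg]
        _ = B * (X * A * B) := by simp only [mul_assoc]

/-- An element of order 5 of `PGL₂` is not conjugate to its square in characteristic not 5. -/
lemma no_sq (h5 : (5 : F) ≠ 0) {c x : P F} (hc : c ^ 5 = 1) (hc1 : c ≠ 1)
    (h : x * c * x⁻¹ = c ^ 2) : False := by
  induction c using QuotientGroup.induction_on with | H C => ?_
  induction x using QuotientGroup.induction_on with | H X => ?_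
  have ns : ∀ c : F, (C : Matrix (Fin 2) (Fin 2) F) ≠ c • 1 := fun c h => hc1 (mk_eq_one h)
  obtain ⟨s, hs⟩ := mk_eq (g := 1) (h := C ^ 5) (by rw [QuotientGroup.mk_pow, hc]; rfl)
  obtain ⟨l, hl⟩ := mk_eq (g := C ^ 2) (h := X * C * X⁻¹) (by
    rw [QuotientGroup.mk_pow, ← h]; rfl)
  have hdet := congrArg det hl
  have htr := congrArg trace hl
  have hX : trace (X * C * X⁻¹ : GL (Fin 2) F).val = trace C.val := by
    rw [Units.val_mul, trace_mul_comm, ← Units.val_mul]; congr 2; group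
  have hXd : det (X * C * X⁻¹ : GL (Fin 2) F).val = det C.val := by
    rw [Units.val_mul, det_mul_comm, ← Units.val_mul]; congr 2; group
  rw [hX] at htr
  rw [hXd] at hdet
  have hD : det C.val ≠ 0 := C.det.ne_zero
  have hch := ch C.val
  simp only [Units.val_pow_eq_pow_val, Units.val_one] at htr hdet hs
  rw [det_smul, det_pow, Fintype.card_fin] at hdet
  rw [trace_smul, sq, hch, trace_sub, trace_smul, trace_smul, trace_one, Fintype.card_fin] at htr
  generalize det C.val = D at *
  generalize trace C.val = t at *
  simp only [smul_eq_mul, Nat.cast_ofNat] at htr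
  have h4 : C.val ^ 5 = (t ^ 4 - 3 * t ^ 2 * D + D ^ 2) • C.val
      - (D * (t ^ 3 - 2 * t * D)) • 1 := by
    have e2 : C.val ^ 2 = t • C.val - D • 1 := by rw [sq, hch]
    have e4 : C.val ^ 4 = (t ^ 3 - 2 * t * D) • C.val - (t ^ 2 * D - D ^ 2) • 1 := by
      rw [show 4 = 2 + 2 from rfl, pow_add, e2]
      simp only [sub_mul, mul_sub, smul_mul_smul_comm, hch, mul_one, one_mul]
      module
    rw [pow_succ, e4, sub_mul, smul_mul_assoc, hch, smul_mul_assoc, one_mul]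
    module
  have hk : t ^ 4 - 3 * t ^ 2 * D + D ^ 2 = 0 := by
    by_contra hk
    generalize t ^ 4 - 3 * t ^ 2 * D + D ^ 2 = k at *
    apply ns (k⁻¹ * (s + D * (t ^ 3 - 2 * t * D)))
    have : k • C.val = (s + D * (t ^ 3 - 2 * t * D)) • (1 : Matrix (Fin 2) (Fin 2) F) := by
      rw [add_smul, ← hs, h4]; abel
    rw [mul_smul, ← this, smul_smul, inv_mul_cancel₀ hk, one_smul]
  have hl2 : l ^ 2 * D = 1 := by
    apply mul_right_cancel₀ hD; linear_combination -hdet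
  -- put `τ = l t`, then `τ = τ² - 2` and `τ⁴ - 3 τ² + 1 = 0`
  have e1 : l * t = (l * t) ^ 2 - 2 := by linear_combination l * htr - 2 * hl2
  have e2 : (l * t) ^ 4 - 3 * (l * t) ^ 2 + 1 = 0 := by
    linear_combination l ^ 4 * hk + (3 * t ^ 2 * l ^ 2 - l ^ 2 * D - 1) * hl2
  generalize l * t = τ at *
  have e3 : 2 * τ + 1 = 0 := by
    linear_combination e2 + (τ ^ 2 + τ) * e1
  apply h5
  linear_combination 4 * e1 + (2 * τ - 3) * e3

end lin

/-! ### Groups -/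

lemma exists_hom {G Q : Type*} [Group G] [Group Q] (f : Q →* G) (hf : Function.Injective f)
    (x : G) (hx : ∀ p, ∃ p', x * f p * x⁻¹ = f p') :
    ∃ φ : Q →* Q, Function.Injective φ ∧ ∀ p, x * f p * x⁻¹ = f (φ p) := by
  choose φ hφ using hx
  refine ⟨MonoidHom.mk' φ fun p q => hf ?_, fun p q h => hf ?_, hφ⟩
  · rw [← hφ, map_mul, map_mul, ← hφ, ← hφ]; group
  · have h' : φ p = φ q := h
    have := hφ p
    rw [h', ← hφ q] at this
    simpa using this

lemma norm_mul {G Q : Type*} [Group G] [Group Q] (f : Q →* G)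
    {x : G} (hx : ∀ p, ∃ p', x * f p * x⁻¹ = f p') (h : Q) :
    ∀ p, ∃ p', (f h⁻¹ * x) * f p * (f h⁻¹ * x)⁻¹ = f p' := by
  intro p
  obtain ⟨p', hp⟩ := hx p
  refine ⟨h⁻¹ * p' * h, ?_⟩
  rw [map_mul, map_mul, ← hp]
  simp only [map_inv]
  group

lemma adj {G Q : Type*} [Group G] [Group Q] (f : Q →* G)
    {x : G} {h p p' q : Q} (h1 : x * f p * x⁻¹ = f p') (h2 : h * q * h⁻¹ = p') :
    (f h⁻¹ * x) * f p * (f h⁻¹ * x)⁻¹ = f q := by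
  have : q = h⁻¹ * p' * h := by rw [← h2]; group
  rw [this, map_mul, map_mul, ← h1]
  simp only [map_inv]
  group

lemma mem_of_klein {F Q : Type*} [Field F] [Group Q] (h2 : (2 : F) ≠ 0) (f : Q →* P F)
    (hf : Function.Injective f) {a b : Q} {x : P F} (ha : a ^ 2 = 1) (hb : b ^ 2 = 1)
    (ha1 : a ≠ 1) (hb1 : b ≠ 1) (hab : a ≠ b) (hc : a * b = b * a)
    (hxa : x * f a * x⁻¹ = f a) (hxb : x * f b * x⁻¹ = f b) : x ∈ f.range := by
  have := klein h2 (a := f a) (b := f b) (x := x) (by rw [← map_pow, ha, map_one])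
    (by rw [← map_pow, hb, map_one]) (by rwa [Ne, map_eq_one_iff f hf])
    (by rwa [Ne, map_eq_one_iff f hf]) (hf.ne hab) (by rw [← map_mul, hc, map_mul])
    (by rwa [mul_inv_eq_iff_eq_mul] at hxa) (by rwa [mul_inv_eq_iff_eq_mul] at hxb)
  have ra : f a ∈ f.range := ⟨a, rfl⟩
  have rb : f b ∈ f.range := ⟨b, rfl⟩
  rcases this with h | h | h | h
  · rw [h]; exact one_mem _
  · exact (Subgroup.mul_mem_cancel_right _ ra).mp (h ▸ one_mem _)
  · exact (Subgroup.mul_mem_cancel_right _ rb).mp (h ▸ one_mem _)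
  · exact (Subgroup.mul_mem_cancel_right _ ra).mp
      ((Subgroup.mul_mem_cancel_right _ rb).mp (h ▸ one_mem _))

lemma s4_mem {F : Type*} [Field F] (h2 : (2 : F) ≠ 0) (f : Equiv.Perm (Fin 4) →* P F)
    (hf : Function.Injective f) (x : P F) (hx : ∀ p, ∃ p', x * f p * x⁻¹ = f p') :
    x ∈ f.range := by
  obtain ⟨fa, fb, fa1, fb1, fab, fc⟩ := s4_facts
  obtain ⟨⟨s, hs⟩, ⟨r, hr⟩⟩ := s4_sq
  obtain ⟨φ, iφ, hφ⟩ := exists_hom f hf x hx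
  obtain ⟨h, hh⟩ := s4_step1 (φ s) (by rw [← map_pow, hs, ← map_pow, fa, map_one])
    (by rw [← map_pow, hs, Ne, map_eq_one_iff φ iφ]; exact fa1)
  rw [← map_pow, hs] at hh
  have ea := adj f (hφ a4) hh
  have hx' := norm_mul f hx h
  suffices hm : f h⁻¹ * x ∈ f.range from (Subgroup.mul_mem_cancel_left f.range (MonoidHom.mem_range.mpr ⟨h⁻¹, rfl⟩)).mp hm
  generalize f h⁻¹ * x = y at *
  obtain ⟨ψ, iψ, hψ⟩ := exists_hom f hf y hx'
  have ψa : ψ a4 = a4 := hf (by rw [← hψ, ea])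
  obtain ⟨k, hk1, hk2⟩ := s4_step2 (ψ r) (by rw [← map_pow, hr, ← map_pow, fb, map_one])
    (by rw [← map_pow, hr, Ne, map_eq_one_iff ψ iψ]; exact fb1)
    (by rw [← map_pow, hr]; exact fun h => iψ.ne fab.symm (h.trans ψa.symm))
  rw [← map_pow, hr] at hk2
  have ea' := adj f ea hk1
  have eb' := adj f (hψ b4) hk2
  exact (Subgroup.mul_mem_cancel_left f.range (MonoidHom.mem_range.mpr ⟨k⁻¹, rfl⟩)).mp
    (mem_of_klein h2 f hf fa fb fa1 fb1 fab fc ea' eb')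

lemma a5_mem {F : Type*} [Field F] (h2 : (2 : F) ≠ 0) (h5 : (5 : F) ≠ 0)
    (f : alternatingGroup (Fin 5) →* P F)
    (hf : Function.Injective f) (x : P F) (hx : ∀ p, ∃ p', x * f p * x⁻¹ = f p') :
    x ∈ f.range := by
  obtain ⟨fa, fb, fa1, fb1, fab, fc, c5', c1, ac⟩ := a5_facts
  obtain ⟨φ, iφ, hφ⟩ := exists_hom f hf x hx
  obtain ⟨h, hh⟩ := a5_step1 (φ c5) (by rw [← map_pow, c5', map_one])
    (by rw [Ne, map_eq_one_iff φ iφ]; exact c1)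
  have ec : f h⁻¹ * x * f c5 * (f h⁻¹ * x)⁻¹ = f c5 := by
    rcases hh with hh | hh
    · exact adj f (hφ c5) hh
    · exfalso
      have := adj f (hφ c5) hh
      rw [map_pow] at this
      exact no_sq h5 (by rw [← map_pow, c5', map_one])
        (by rw [Ne, map_eq_one_iff f hf]; exact c1) this
  have hx' := norm_mul f hx h
  suffices hm : f h⁻¹ * x ∈ f.range from (Subgroup.mul_mem_cancel_left f.range (MonoidHom.mem_range.mpr ⟨h⁻¹, rfl⟩)).mp hm
  generalize f h⁻¹ * x = y at *
  obtain ⟨ψ, iψ, hψ⟩ := exists_hom f hf y hx'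
  have ψc : ψ c5 = c5 := hf (by rw [← hψ, ec])
  obtain ⟨k, hk1, hk2⟩ := a5_step2 (ψ a5) (by rw [← map_pow, fa, map_one])
    (by rw [Ne, map_eq_one_iff ψ iψ]; exact fa1)
    (by rw [show ψ a5 * c5 = ψ a5 * ψ c5 by rw [ψc], ← map_mul, ← map_pow, ac, map_one])
  have ec' := adj f ec hk1
  have ea' := adj f (hψ a5) hk2
  have hx'' := norm_mul f hx' k
  suffices hm : f k⁻¹ * y ∈ f.range from (Subgroup.mul_mem_cancel_left f.range (MonoidHom.mem_range.mpr ⟨k⁻¹, rfl⟩)).mp hm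
  generalize f k⁻¹ * y = z at *
  obtain ⟨χ, iχ, hχ⟩ := exists_hom f hf z hx''
  have χc : χ c5 = c5 := hf (by rw [← hχ, ec'])
  have χa : χ a5 = a5 := hf (by rw [← hχ, ea'])
  have χb : χ b5 = b5 := by simp only [b5, map_mul, map_pow, χc, χa]
  exact mem_of_klein h2 f hf fa fb fa1 fb1 fab fc ea' (by rw [hχ, χb])

lemma exists_normalizing {G : Type*} [Group G] (H H₁ : Subgroup G) [Finite H] (hle : H ≤ H₁)
    (hcard : Nat.card H₁ = 2 * Nat.card H) :
    ∃ x, x ∉ H ∧ ∀ y ∈ H, x * y * x⁻¹ ∈ H := by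
  have hpos : 0 < Nat.card H := Nat.card_pos
  have hidx : (H.subgroupOf H₁).index = 2 := by
    have h1 := Subgroup.card_mul_index (H.subgroupOf H₁)
    rw [Nat.card_congr (Subgroup.subgroupOfEquivOfLe hle).toEquiv, hcard, mul_comm] at h1
    exact Nat.eq_of_mul_eq_mul_right hpos h1
  have hn := Subgroup.normal_of_index_eq_two hidx
  have hne : ∃ x ∈ H₁, x ∉ H := by
    by_contra! hcon
    have : H = H₁ := le_antisymm hle hcon
    rw [← this] at hcard
    omega
  obtain ⟨x, hx1, hx⟩ := hne
  refine ⟨x, hx, fun y hy => ?_⟩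
  have := hn.conj_mem ⟨y, hle hy⟩ (by simpa [Subgroup.mem_subgroupOf] using hy) ⟨x, hx1⟩
  simpa [Subgroup.mem_subgroupOf] using this

lemma natCast_ne_zero {F : Type*} [Field F] [Fintype F] {n p : ℕ} (hpn : p ∣ n)
    (h : Nat.gcd (Fintype.card F) n = 1) : (p : F) ≠ 0 := by
  intro h0
  have hcop : Nat.Coprime p (Fintype.card F) := (Nat.Coprime.coprime_dvd_right hpn h).symm
  have := Nat.isCoprime_iff_coprime.mpr hcop
  obtain ⟨u, v, huv⟩ := this
  have h1 := congrArg (Int.cast : ℤ → F) huv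
  simp [h0] at h1

end PGLAux

/-- Let `F` be a finite field of order `q`, let `L ≅ PSL₂(q)` be the image of
`SL₂(F)` in `PGL₂(F)`, and let `H ≤ L` be such that either `gcd(q,6) = 1` and
`H ≅ Sym₄`, or `gcd(q,30) = 1` and `H ≅ SL₂(4) ≅ Alt₅`. Then there is no
subgroup `H₁` of `PGL₂(F)` with `H₁ ∩ L = H` and `|H₁| = 2|H|`. -/
theorem stmt_13 (F : Type*) [Field F] [Fintype F]
    (H : Subgroup (Matrix.GeneralLinearGroup (Fin 2) F ⧸
      Subgroup.center (Matrix.GeneralLinearGroup (Fin 2) F)))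
    (hHL : H ≤ (SLtoPGL F).range)
    (hcase :
      (Nat.gcd (Fintype.card F) 6 = 1 ∧ Nonempty (H ≃* Equiv.Perm (Fin 4))) ∨
      (Nat.gcd (Fintype.card F) 30 = 1 ∧
        Nonempty (H ≃* alternatingGroup (Fin 5)))) :
    ¬ ∃ H₁ : Subgroup (Matrix.GeneralLinearGroup (Fin 2) F ⧸
        Subgroup.center (Matrix.GeneralLinearGroup (Fin 2) F)),
      H₁ ⊓ (SLtoPGL F).range = H ∧ Nat.card H₁ = 2 * Nat.card H := by
  rintro ⟨H₁, hint, hcard⟩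
  have hle : H ≤ H₁ := hint ▸ inf_le_left
  have : Finite H := by
    rcases hcase with ⟨-, ⟨e⟩⟩ | ⟨-, ⟨e⟩⟩
    · exact Finite.of_equiv _ e.symm.toEquiv
    · exact Finite.of_equiv _ e.symm.toEquiv
  obtain ⟨x, hx, hnorm⟩ := PGLAux.exists_normalizing H H₁ hle hcard
  apply hx
  rcases hcase with ⟨hq, ⟨e⟩⟩ | ⟨hq, ⟨e⟩⟩
  · have h2 : (2 : F) ≠ 0 := by
      exact_mod_cast PGLAux.natCast_ne_zero (F := F) (p := 2) (by norm_num) hq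
    obtain ⟨p, hp⟩ := PGLAux.s4_mem h2 (H.subtype.comp e.symm.toMonoidHom)
      (H.subtype_injective.comp e.symm.injective) x
      (fun p => ⟨e ⟨_, hnorm _ (e.symm p).2⟩, by simp⟩)
    rw [← hp]
    exact (e.symm p).2
  · have h2 : (2 : F) ≠ 0 := by
      exact_mod_cast PGLAux.natCast_ne_zero (F := F) (p := 2) (by norm_num) hq
    have h5 : (5 : F) ≠ 0 := by
      exact_mod_cast PGLAux.natCast_ne_zero (F := F) (p := 5) (by norm_num) hq
    obtain ⟨p, hp⟩ := PGLAux.a5_mem h2 h5 (H.subtype.comp e.symm.toMonoidHom)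
      (H.subtype_injective.comp e.symm.injective) x
      (fun p => ⟨e ⟨_, hnorm _ (e.symm p).2⟩, by simp⟩)
    rw [← hp]
    exact (e.symm p).2
end

section
/- Let F be a finite field of odd order q and characteristic p, and let π be a set of primes with 2 ∈ π, 3 ∈ π, and p ∉ π. Let ε ∈ {1, −1} be such that q ≡ ε (mod 4). Suppose one of the following holds: (a) every prime in π dividing q² − 1 divides q − ε; (b) the set of primes in π dividing q² − 1 is {2, 3} and (q² − 1)_{{2,3}} = 24; (c) the set of primes in π dividing q² − 1 is {2, 3} and (q² − 1)_{{2,3}} = 48; (d) the set of primes in π dividing q² − 1 is {2, 3, 5} and (q² − 1)_{{2,3,5}} = 120. Then SL_2(F) possesses a π-Hall subgroup. -/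
/-- `n` is a `π`-number: every prime dividing `n` lies in `π`. -/
def IsPiNumber (π : Set ℕ) (n : ℕ) : Prop :=
  ∀ p : ℕ, p.Prime → p ∣ n → p ∈ π

/-- `H` is a `π`-Hall subgroup of `G`: its order is a `π`-number and no prime
in `π` divides its index. -/
def IsHallPi (π : Set ℕ) {G : Type*} [Group G] (H : Subgroup G) : Prop :=
  IsPiNumber π (Nat.card H) ∧ ∀ p ∈ π, p.Prime → ¬ p ∣ H.index

/-- The conjugate `g K g⁻¹` of a subgroup `K`. -/
def conjSub {G : Type*} [Group G] (g : G) (K : Subgroup G) : Subgroup G :=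
  K.map (MulAut.conj g).toMonoidHom

open scoped Classical in
/-- The `π`-part of `m`: the largest divisor of `m` that is a `π`-number. -/
noncomputable def piPart (π : Set ℕ) (m : ℕ) : ℕ :=
  ∏ p ∈ m.primeFactors, if p ∈ π then p ^ m.factorization p else 1


lemma card_closure_le {G : Type*} [Group G] [Finite G] (H : Subgroup G) (X : Finset G)
    (Y : Set G) (h1 : (1 : G) ∈ X)
    (h : ∀ y ∈ Y, ∀ x ∈ X, ∃ x' ∈ X, x'⁻¹ * (y * x) ∈ H) :
    Nat.card (Subgroup.closure Y) ≤ X.card * Nat.card H := by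
  classical
  have key : ∀ u ∈ Submonoid.closure Y, ∃ x ∈ X, x⁻¹ * u ∈ H := by
    intro u hu
    induction hu using Submonoid.closure_induction_left with
    | one => exact ⟨1, h1, by simp⟩
    | mul_left y hy u _ ih =>
      obtain ⟨x, hx, hxu⟩ := ih
      obtain ⟨x', hx', hh⟩ := h y hy x hx
      refine ⟨x', hx', ?_⟩
      have := H.mul_mem hh hxu
      simpa [mul_assoc] using this
  have hsub : ∀ u : Subgroup.closure Y, ∃ p : X × H, (p.1 : G) * p.2 = u := by
    rintro ⟨u, hu⟩
    rw [← Subgroup.mem_toSubmonoid, Subgroup.closure_toSubmonoid_of_finite] at hu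
    obtain ⟨x, hx, hxu⟩ := key u hu
    exact ⟨(⟨x, hx⟩, ⟨_, hxu⟩), by simp⟩
  choose f hf using hsub
  have hinj : Function.Injective f := by
    intro a b hab
    apply Subtype.ext
    rw [← hf a, ← hf b, hab]
  have := Nat.card_le_card_of_injective f hinj
  simpa [Nat.card_prod] using this

lemma card_double {G : Type*} [Group G] [Finite G] (S : Set G) (w : G)
    (h : ∀ s ∈ S, w⁻¹ * (s * w) ∈ Subgroup.closure S) (hw : w * w ∈ Subgroup.closure S)
    (hn : w ∉ Subgroup.closure S) :
    Nat.card (Subgroup.closure (insert w S)) = 2 * Nat.card (Subgroup.closure S) := by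
  classical
  have hle : Subgroup.closure S ≤ Subgroup.closure (insert w S) :=
    Subgroup.closure_mono (Set.subset_insert _ _)
  have hub : Nat.card (Subgroup.closure (insert w S)) ≤ 2 * Nat.card (Subgroup.closure S) := by
    refine (card_closure_le (Subgroup.closure S) {1, w} (insert w S) (by simp) ?_).trans
      (Nat.mul_le_mul_right _ Finset.card_le_two)
    rintro y (rfl | hy) x hx
    · simp only [Finset.mem_insert, Finset.mem_singleton] at hx
      rcases hx with rfl | rfl
      · exact ⟨y, by simp, by simp⟩
      · exact ⟨1, by simp, by simpa using hw⟩
    · simp only [Finset.mem_insert, Finset.mem_singleton] at hx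
      rcases hx with rfl | rfl
      · exact ⟨1, by simp, by simpa using Subgroup.subset_closure hy⟩
      · exact ⟨x, by simp, h y hy⟩
  obtain ⟨k, hk⟩ := Subgroup.card_dvd_of_le hle
  have hpos : 0 < Nat.card (Subgroup.closure S) := Nat.card_pos
  have hpos' : 0 < Nat.card (Subgroup.closure (insert w S)) := Nat.card_pos
  have hk2 : k ≤ 2 := by
    rw [hk, mul_comm] at hub
    exact Nat.le_of_mul_le_mul_right hub hpos
  have hk0 : k ≠ 0 := by rintro rfl; omega
  have hk1 : k ≠ 1 := by
    rintro rfl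
    have := Subgroup.eq_of_le_of_card_ge hle (by omega)
    exact hn (this ▸ Subgroup.subset_closure (Set.mem_insert _ _))
  obtain rfl : k = 2 := by omega
  omega

lemma exists_dicyclic {G C : Type*} [Group G] [Finite G] [CommGroup C] [Finite C] [IsCyclic C]
    (f : C →* G) (hf : Function.Injective f) (w : G) (hw : ∀ c, f c * w = w * f c⁻¹)
    (hn : w ∉ f.range) (z : C) (hz : f z = w * w) (hz2 : z ^ 2 = 1) (n : ℕ)
    (hnC : n ∣ Nat.card C) (h2 : 2 ∣ n) : ∃ H : Subgroup G, Nat.card H = 2 * n := by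
  set A : Subgroup G := (powMonoidHom n : C →* C).ker.map f with hA
  have hcA : Nat.card A = n := by
    rw [hA, Subgroup.card_map_of_injective hf, IsCyclic.card_powMonoidHom_ker,
      Nat.gcd_eq_right hnC]
  refine ⟨Subgroup.closure (insert w (A : Set G)), ?_⟩
  rw [card_double, Subgroup.closure_eq, hcA]
  · rw [Subgroup.closure_eq]
    rintro s ⟨c, hc, rfl⟩
    rw [hw]
    refine ⟨c⁻¹, inv_mem hc, by simp⟩
  · rw [Subgroup.closure_eq, ← hz]
    refine ⟨z, ?_, rfl⟩
    obtain ⟨k, rfl⟩ := h2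
    simp [MonoidHom.mem_ker, pow_mul, hz2]
  · rw [Subgroup.closure_eq]
    rintro ⟨c, -, rfl⟩
    exact hn ⟨c, rfl⟩

/-- quaternion matrix -/
def QM {F : Type*} [Field F] (x y a b c d : F) : Matrix (Fin 2) (Fin 2) F :=
  !![a + c * x + d * y, b + c * y - d * x; -b + c * y - d * x, a - c * x - d * y]

lemma QM_mul {F : Type*} [Field F] {x y : F} (h : x ^ 2 + y ^ 2 = -1) (a b c d a' b' c' d' : F) :
    QM x y a b c d * QM x y a' b' c' d' =
      QM x y (a * a' - b * b' - c * c' - d * d') (a * b' + b * a' + c * d' - d * c')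
        (a * c' - b * d' + c * a' + d * b') (a * d' + b * c' - c * b' + d * a') := by
  ext i j
  fin_cases i <;> fin_cases j <;> simp [QM, Matrix.mul_apply, Fin.sum_univ_two]
  · linear_combination (c * c' + d * d') * h
  · linear_combination -(c * d' - d * c') * h
  · linear_combination -(d * c' - c * d') * h
  · linear_combination (c * c' + d * d') * h

lemma QM_det {F : Type*} [Field F] {x y : F} (h : x ^ 2 + y ^ 2 = -1) (a b c d : F) :
    (QM x y a b c d).det = a ^ 2 + b ^ 2 + c ^ 2 + d ^ 2 := by
  simp [QM, Matrix.det_fin_two]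
  linear_combination (- c^2 - d^2) * h

lemma QM_inj {F : Type*} [Field F] {x y : F} (h : x ^ 2 + y ^ 2 = -1) (h2 : (2 : F) ≠ 0)
    {a b c d a' b' c' d' : F} (he : QM x y a b c d = QM x y a' b' c' d') :
    a = a' ∧ b = b' ∧ c = c' ∧ d = d' := by
  have e1 := congrFun (congrFun he 0) 0
  have e2 := congrFun (congrFun he 0) 1
  have e3 := congrFun (congrFun he 1) 0
  have e4 := congrFun (congrFun he 1) 1
  simp [QM] at e1 e2 e3 e4
  have ha : a = a' := mul_left_cancel₀ h2 (by linear_combination e1 + e4)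
  have hb : b = b' := mul_left_cancel₀ h2 (by linear_combination e2 - e3)
  subst ha hb
  refine ⟨rfl, rfl, ?_, ?_⟩
  · linear_combination -x * e1 - y * e2 + (c-c') * h
  · linear_combination -y * e1 + x * e2 + (d-d') * h

abbrev SL2 (F : Type*) [Field F] := Matrix.SpecialLinearGroup (Fin 2) F

/-- quaternion of norm one in SL2 -/
def QS {F : Type*} [Field F] {x y : F} (h : x ^ 2 + y ^ 2 = -1) (a b c d : F)
    (hn : a ^ 2 + b ^ 2 + c ^ 2 + d ^ 2 = 1) : SL2 F := ⟨QM x y a b c d, by rw [QM_det h, hn]⟩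

lemma QS_mul {F : Type*} [Field F] {x y : F} (h : x ^ 2 + y ^ 2 = -1) (a b c d a' b' c' d' : F)
    (hn : a ^ 2 + b ^ 2 + c ^ 2 + d ^ 2 = 1) (hn' : a' ^ 2 + b' ^ 2 + c' ^ 2 + d' ^ 2 = 1) :
    QS h a b c d hn * QS h a' b' c' d' hn' =
      QS h (a * a' - b * b' - c * c' - d * d') (a * b' + b * a' + c * d' - d * c')
        (a * c' - b * d' + c * a' + d * b') (a * d' + b * c' - c * b' + d * a')
        (by linear_combination (a ^ 2 + b ^ 2 + c ^ 2 + d ^ 2) * hn' + hn) :=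
  Subtype.ext (QM_mul h ..)

lemma QS_one {F : Type*} [Field F] {x y : F} (h : x ^ 2 + y ^ 2 = -1) :
    (1 : SL2 F) = QS h 1 0 0 0 (by ring) := by
  apply Subtype.ext
  ext i j
  fin_cases i <;> fin_cases j <;> simp [QS, QM]

lemma QS_eq {F : Type*} [Field F] {x y : F} (h : x ^ 2 + y ^ 2 = -1) {a b c d a' b' c' d' : F}
    {hn : a ^ 2 + b ^ 2 + c ^ 2 + d ^ 2 = 1} {hn' : a' ^ 2 + b' ^ 2 + c' ^ 2 + d' ^ 2 = 1}
    (h1 : a = a') (h2 : b = b') (h3 : c = c') (h4 : d = d') :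
    QS h a b c d hn = QS h a' b' c' d' hn' := by
  subst h1 h2 h3 h4; rfl

lemma QS_inj {F : Type*} [Field F] {x y : F} (h : x ^ 2 + y ^ 2 = -1) (h2 : (2 : F) ≠ 0)
    {a b c d a' b' c' d' : F}
    {hn : a ^ 2 + b ^ 2 + c ^ 2 + d ^ 2 = 1} {hn' : a' ^ 2 + b' ^ 2 + c' ^ 2 + d' ^ 2 = 1}
    (he : QS h a b c d hn = QS h a' b' c' d' hn') :
    a = a' ∧ b = b' ∧ c = c' ∧ d = d' := QM_inj h h2 (congrArg Subtype.val he)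

/-- Abstract relations of the binary tetrahedral group. -/
structure BT {G : Type*} [Group G] (i j t : G) : Prop where
  i4 : i ^ 4 = 1
  i2 : i ^ 2 ≠ 1
  jj : j * j = i * i
  ij : i * j = j * i ^ 3
  t3 : t ^ 3 = 1
  it : i * t = t * j
  jt : j * t = t * (i * j)

section
variable {G : Type*} [Group G] {i j t : G}

lemma BT.orderOf_i (h : BT i j t) : orderOf i = 4 := by
  have := orderOf_eq_prime_pow (p := 2) (n := 1) (x := i) (by simpa using h.i2)
    (by simpa using h.i4)
  simpa using this

lemma BT.not_comm (h : BT i j t) : i * j ≠ j * i := by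
  intro hc
  rw [h.ij] at hc
  have h3 := mul_left_cancel hc
  apply h.i2
  have : i * i ^ 2 = i * 1 := by rw [← pow_succ', h3, mul_one]
  exact mul_left_cancel this

lemma BT.card_Q [Finite G] (h : BT i j t) : Nat.card (Subgroup.closure {j, i} : Subgroup G) = 8 := by
  rw [card_double, ← Subgroup.zpowers_eq_closure, Nat.card_zpowers, h.orderOf_i]
  · rintro s rfl
    rw [h.ij, inv_mul_cancel_left]
    exact pow_mem (Subgroup.mem_closure_singleton_self _) _
  · rw [h.jj]
    exact mul_mem (Subgroup.mem_closure_singleton_self _) (Subgroup.mem_closure_singleton_self _)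
  · rw [← Subgroup.zpowers_eq_closure]
    rintro ⟨n, rfl⟩
    exact h.not_comm ((Commute.refl i).zpow_right n)

lemma BT.card_T [Finite G] (h : BT i j t) : Nat.card (Subgroup.closure {t, j, i} : Subgroup G) = 24 := by
  classical
  have hub : Nat.card (Subgroup.closure {t, j, i} : Subgroup G) ≤ 3 * 8 := by
    rw [← h.card_Q]
    refine (card_closure_le (Subgroup.closure {j, i}) {1, t, t * t} _ (by simp) ?_).trans
      (Nat.mul_le_mul_right _ Finset.card_le_three)
    have hi : i ∈ (Subgroup.closure {j, i} : Subgroup G) := Subgroup.subset_closure (by simp)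
    have hj : j ∈ (Subgroup.closure {j, i} : Subgroup G) := Subgroup.subset_closure (by simp)
    have hit2 : i * (t * t) = (t * t) * (i * j) := by
      rw [← mul_assoc, h.it, mul_assoc, h.jt, mul_assoc]
    have hjt2 : j * (t * t) = (t * t) * (j * (i * j)) := by
      rw [← mul_assoc, h.jt, mul_assoc, mul_assoc, h.jt, ← mul_assoc i t, h.it]
      simp only [mul_assoc]
    have ht3 : t * (t * t) = 1 := by rw [← h.t3, pow_succ', pow_two]
    intro y hy x hx
    simp only [Set.mem_insert_iff, Set.mem_singleton_iff] at hy
    simp only [Finset.mem_insert, Finset.mem_singleton] at hx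
    rcases hy with rfl | rfl | rfl <;> rcases hx with rfl | rfl | rfl
    · exact ⟨y, by simp, by simp⟩
    · exact ⟨x * x, by simp, by simp⟩
    · exact ⟨1, by simp, by simp [ht3]⟩
    · exact ⟨1, by simp, by simpa using hj⟩
    · exact ⟨x, by simp, by rw [h.jt, inv_mul_cancel_left]; exact mul_mem hi hj⟩
    · exact ⟨t * t, by simp, by
        rw [hjt2, inv_mul_cancel_left]; exact mul_mem hj (mul_mem hi hj)⟩
    · exact ⟨1, by simp, by simpa using hi⟩
    · exact ⟨x, by simp, by rw [h.it, inv_mul_cancel_left]; exact hj⟩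
    · exact ⟨t * t, by simp, by rw [hit2, inv_mul_cancel_left]; exact mul_mem hi hj⟩
  have h8 : 8 ∣ Nat.card (Subgroup.closure {t, j, i} : Subgroup G) := by
    rw [← h.card_Q]
    exact Subgroup.card_dvd_of_le (Subgroup.closure_mono (Set.subset_insert _ _))
  have h3 : 3 ∣ Nat.card (Subgroup.closure {t, j, i} : Subgroup G) := by
    have ht : orderOf t = 3 := by
      refine orderOf_eq_prime h.t3 ?_
      rintro rfl
      have := h.it
      simp at this
      subst this
      exact h.not_comm rfl
    rw [← ht]
    exact Subgroup.orderOf_dvd_natCard _ (Subgroup.subset_closure (by simp))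
  have hpos : 0 < Nat.card (Subgroup.closure {t, j, i} : Subgroup G) := Nat.card_pos
  omega

lemma BT.card_O [Finite G] (h : BT i j t) (o : G) (ho : o * o = i) (hoj : j * o = o * (j * i))
    (hoj2 : o * j = j * o ^ 7) (hot : t * o = o * (i * t * i * t)) :
    Nat.card (Subgroup.closure {o, t, j, i} : Subgroup G) = 48 := by
  have hi : i ∈ (Subgroup.closure {t, j, i} : Subgroup G) := Subgroup.subset_closure (by simp)
  have hj : j ∈ (Subgroup.closure {t, j, i} : Subgroup G) := Subgroup.subset_closure (by simp)
  have ht : t ∈ (Subgroup.closure {t, j, i} : Subgroup G) := Subgroup.subset_closure (by simp)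
  have hoi : i * o = o * i := by rw [← ho, mul_assoc]
  rw [card_double, h.card_T]
  · intro s hs
    simp only [Set.mem_insert_iff, Set.mem_singleton_iff] at hs
    rcases hs with rfl | rfl | rfl
    · rw [hot, inv_mul_cancel_left]
      exact mul_mem (mul_mem (mul_mem hi ht) hi) ht
    · rw [hoj, inv_mul_cancel_left]
      exact mul_mem hj hi
    · rw [hoi, inv_mul_cancel_left]
      exact hi
  · rw [ho]; exact hi
  · intro hmem
    have ho8 : orderOf o = 8 := by
      have := orderOf_eq_prime_pow (p := 2) (n := 2) (x := o)
        (by rw [show 2 ^ 2 = 2 * 2 from rfl, pow_mul, pow_two o, ho]; exact h.i2)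
        (by rw [show 2 ^ (2 + 1) = 2 * 4 from rfl, pow_mul, pow_two o, ho]; exact h.i4)
      simpa using this
    have h16 : Nat.card (Subgroup.closure {j, o} : Subgroup G) = 16 := by
      have hoC : o ∈ Subgroup.closure ({o} : Set G) := Subgroup.mem_closure_singleton_self _
      rw [card_double, ← Subgroup.zpowers_eq_closure, Nat.card_zpowers, ho8]
      · rintro s rfl
        rw [hoj2, inv_mul_cancel_left]
        exact pow_mem hoC _
      · rw [h.jj, ← ho]
        exact mul_mem (mul_mem hoC hoC) (mul_mem hoC hoC)
      · rw [← Subgroup.zpowers_eq_closure]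
        rintro ⟨n, rfl⟩
        apply h.not_comm
        rw [← ho]
        exact ((Commute.refl o).mul_left (Commute.refl o)).zpow_right n
    have hle : (Subgroup.closure {j, o} : Subgroup G) ≤ Subgroup.closure {t, j, i} := by
      rw [Subgroup.closure_le]
      rintro s (rfl | rfl)
      exacts [hj, hmem]
    have := Subgroup.card_dvd_of_le hle
    rw [h16, h.card_T] at this
    norm_num at this

lemma BT.card_I [Finite G] (h : BT i j t) (g : G) (hg5 : g ^ 5 = 1) (hg1 : g ≠ 1)
    (hig : i * g = g ^ 4 * i) (h1 : t * g = g * (j * i * t * t))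
    (h2 : t * g ^ 2 = g ^ 3 * (i * i * t * t)) (h3 : t * g ^ 3 = g ^ 4 * (i * t * i))
    (h4 : t * g ^ 4 = g ^ 2 * (i * i * j)) :
    Nat.card (Subgroup.closure {g, t, i} : Subgroup G) = 120 := by
  classical
  have hi : i ∈ (Subgroup.closure {t, j, i} : Subgroup G) := Subgroup.subset_closure (by simp)
  have hj : j ∈ (Subgroup.closure {t, j, i} : Subgroup G) := Subgroup.subset_closure (by simp)
  have ht : t ∈ (Subgroup.closure {t, j, i} : Subgroup G) := Subgroup.subset_closure (by simp)
  have hub : Nat.card (Subgroup.closure {g, t, i} : Subgroup G) ≤ 5 * 24 := by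
    rw [← h.card_T]
    refine (card_closure_le (Subgroup.closure {t, j, i}) {1, g, g ^ 2, g ^ 3, g ^ 4} _
      (by simp) ?_).trans (Nat.mul_le_mul_right _ Finset.card_le_five)
    have e2 : i * g ^ 2 = g ^ 3 * i := by
      rw [pow_two, ← mul_assoc, hig, mul_assoc, hig, ← mul_assoc, ← pow_add,
        show 4 + 4 = 5 + 3 from rfl, pow_add, hg5, one_mul]
    have e3 : i * g ^ 3 = g ^ 2 * i := by
      rw [pow_succ g 2, ← mul_assoc, e2, mul_assoc, hig, ← mul_assoc, ← pow_add,
        show 3 + 4 = 5 + 2 from rfl, pow_add, hg5, one_mul]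
    have e4 : i * g ^ 4 = g * i := by
      rw [pow_succ g 3, ← mul_assoc, e3, mul_assoc, hig, ← mul_assoc, ← pow_add,
        show 2 + 4 = 5 + 1 from rfl, pow_add, hg5, one_mul, pow_one]
    intro y hy x hx
    simp only [Set.mem_insert_iff, Set.mem_singleton_iff] at hy
    simp only [Finset.mem_insert, Finset.mem_singleton] at hx
    rcases hy with rfl | rfl | rfl
    · rcases hx with rfl | rfl | rfl | rfl | rfl
      · exact ⟨y, by simp, by simp⟩
      · exact ⟨x ^ 2, by simp, by simp [pow_two]⟩
      · exact ⟨y ^ 3, by simp, by rw [← pow_succ', inv_mul_cancel]; exact one_mem _⟩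
      · exact ⟨y ^ 4, by simp, by rw [← pow_succ', inv_mul_cancel]; exact one_mem _⟩
      · exact ⟨1, by simp, by rw [← pow_succ', hg5]; simp⟩
    · rcases hx with rfl | rfl | rfl | rfl | rfl
      · exact ⟨1, by simp, by simpa using ht⟩
      · exact ⟨x, by simp, by
          rw [h1, inv_mul_cancel_left]; exact mul_mem (mul_mem (mul_mem hj hi) ht) ht⟩
      · exact ⟨g ^ 3, by simp, by
          rw [h2, inv_mul_cancel_left]; exact mul_mem (mul_mem (mul_mem hi hi) ht) ht⟩
      · exact ⟨g ^ 4, by simp, by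
          rw [h3, inv_mul_cancel_left]; exact mul_mem (mul_mem hi ht) hi⟩
      · exact ⟨g ^ 2, by simp, by
          rw [h4, inv_mul_cancel_left]; exact mul_mem (mul_mem hi hi) hj⟩
    · rcases hx with rfl | rfl | rfl | rfl | rfl
      · exact ⟨1, by simp, by simpa using hi⟩
      · exact ⟨x ^ 4, by simp, by rw [hig, inv_mul_cancel_left]; exact hi⟩
      · exact ⟨g ^ 3, by simp, by rw [e2, inv_mul_cancel_left]; exact hi⟩
      · exact ⟨g ^ 2, by simp, by rw [e3, inv_mul_cancel_left]; exact hi⟩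
      · exact ⟨g, by simp, by rw [e4, inv_mul_cancel_left]; exact hi⟩
  have hle : (Subgroup.closure {t, j, i} : Subgroup G) ≤ Subgroup.closure {g, t, i} := by
    have hi' : i ∈ (Subgroup.closure {g, t, i} : Subgroup G) := Subgroup.subset_closure (by simp)
    have ht' : t ∈ (Subgroup.closure {g, t, i} : Subgroup G) := Subgroup.subset_closure (by simp)
    have hj' : j = t⁻¹ * (i * t) := by rw [h.it, inv_mul_cancel_left]
    rw [Subgroup.closure_le]
    rintro s (rfl | rfl | rfl)
    · exact ht'
    · rw [hj']; exact mul_mem (inv_mem ht') (mul_mem hi' ht')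
    · exact hi'
  have d24 := Subgroup.card_dvd_of_le hle
  rw [h.card_T] at d24
  have d5 : 5 ∣ Nat.card (Subgroup.closure {g, t, i} : Subgroup G) := by
    have : Fact (Nat.Prime 5) := ⟨by norm_num⟩
    rw [← orderOf_eq_prime hg5 hg1]
    exact Subgroup.orderOf_dvd_natCard _ (Subgroup.subset_closure (by simp))
  have hpos : 0 < Nat.card (Subgroup.closure {g, t, i} : Subgroup G) := Nat.card_pos
  omega
end

section
variable {F : Type*} [Field F] {x y : F}

/-- i -/
def qi (h : x ^ 2 + y ^ 2 = -1) : SL2 F := QS h 0 1 0 0 (by ring)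
/-- j -/
def qj (h : x ^ 2 + y ^ 2 = -1) : SL2 F := QS h 0 0 1 0 (by ring)
/-- t -/
def qt (h : x ^ 2 + y ^ 2 = -1) {e : F} (he : 2 * e = 1) : SL2 F := QS h (-e) e e e
  (by linear_combination (2 * e + 1) * he)

lemma bt (h : x ^ 2 + y ^ 2 = -1) {e : F} (he : 2 * e = 1) : BT (qi h) (qj h) (qt h he) := by
  have h2 : (2 : F) ≠ 0 := by intro h0; simp [h0] at he
  constructor
  · rw [QS_one h]
    simp only [pow_succ, pow_zero, one_mul, qi, QS_mul]
    apply QS_eq <;> ring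
  · intro hh
    rw [QS_one h] at hh
    simp only [pow_succ, pow_zero, one_mul, qi, QS_mul] at hh
    have := (QS_inj h h2 hh).1
    apply h2
    linear_combination -this
  · simp only [qi, qj, QS_mul]
    apply QS_eq <;> ring
  · simp only [pow_succ, pow_zero, one_mul, qi, qj, QS_mul]
    apply QS_eq <;> ring
  · rw [QS_one h]
    simp only [pow_succ, pow_zero, one_mul, qt, QS_mul]
    apply QS_eq <;> grind
  · simp only [qi, qj, qt, QS_mul]
    apply QS_eq <;> ring
  · simp only [qi, qj, qt, QS_mul]
    apply QS_eq <;> ring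

lemma exists_24 [Finite F] (h : x ^ 2 + y ^ 2 = -1) (h2 : (2 : F) ≠ 0) :
    ∃ H : Subgroup (SL2 F), Nat.card H = 24 :=
  ⟨_, (bt h (mul_inv_cancel₀ h2)).card_T⟩

lemma exists_48 [Finite F] (h : x ^ 2 + y ^ 2 = -1) (h2 : (2 : F) ≠ 0) (hs : IsSquare (2 : F)) :
    ∃ H : Subgroup (SL2 F), Nat.card H = 48 := by
  obtain ⟨s, hs⟩ := hs
  obtain ⟨e, he⟩ : ∃ e : F, 2 * e = 1 := ⟨_, mul_inv_cancel₀ h2⟩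
  obtain ⟨r, hr⟩ : ∃ r : F, 2 * r ^ 2 = 1 := ⟨s * e, by grind⟩
  let o : SL2 F := QS h r r 0 0 (by linear_combination hr)
  refine ⟨_, (bt h he).card_O o ?_ ?_ ?_ ?_⟩
  · simp only [o, qi, QS_mul]
    apply QS_eq <;> grind
  · simp only [o, qi, qj, QS_mul]
    apply QS_eq <;> ring
  · have h7 : o ^ 7 = QS h r (-r) 0 0 (by linear_combination hr) := by
      have h2 : o * o = QS h 0 1 0 0 (by ring) := by
        simp only [o, QS_mul]
        apply QS_eq <;> grind
      have : o ^ 7 = (o * o) * (o * o) * (o * o) * o := by simp only [pow_succ, pow_zero, one_mul, mul_assoc]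
      rw [this, h2]
      simp only [o, QS_mul]
      apply QS_eq <;> ring
    rw [h7]
    simp only [o, qj, QS_mul]
    apply QS_eq <;> ring
  · simp only [o, qi, qt, QS_mul]
    apply QS_eq <;> grind

lemma exists_120 [Finite F] (h : x ^ 2 + y ^ 2 = -1) (h2 : (2 : F) ≠ 0) (hs : IsSquare (5 : F)) :
    ∃ H : Subgroup (SL2 F), Nat.card H = 120 := by
  obtain ⟨s, hs⟩ := hs
  obtain ⟨e, he⟩ : ∃ e : F, 2 * e = 1 := ⟨_, mul_inv_cancel₀ h2⟩
  obtain ⟨f, hf⟩ : ∃ f : F, f ^ 2 = f + 1 := ⟨(1 + s) * e, by grind⟩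
  let g : SL2 F := QS h ((f - 1) * e) 0 (f * e) e (by grind)
  have g2 : g ^ 2 = QS h (-f * e) 0 e ((f - 1) * e) (by grind) := by
    simp only [pow_two, g, QS_mul]
    apply QS_eq <;> grind
  have g3 : g ^ 3 = QS h (-f * e) 0 (-e) ((1 - f) * e) (by grind) := by
    rw [pow_succ, g2]
    simp only [g, QS_mul]
    apply QS_eq <;> grind
  have g4 : g ^ 4 = QS h ((f - 1) * e) 0 (-f * e) (-e) (by grind) := by
    rw [pow_succ, g3]
    simp only [g, QS_mul]
    apply QS_eq <;> grind
  have tt : qt h he * qt h he = QS h (-e) (-e) (-e) (-e) (by grind) := by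
    simp only [qt, QS_mul]
    apply QS_eq <;> grind
  refine ⟨_, (bt h he).card_I g ?_ ?_ ?_ ?_ ?_ ?_ ?_⟩
  · rw [pow_succ, g4, QS_one h]
    simp only [g, QS_mul]
    apply QS_eq <;> grind
  · rw [QS_one h]
    intro hh
    have := (QS_inj h h2 hh).2.2.2
    simp [this] at he
  · rw [g4]
    simp only [g, qi, QS_mul]
    apply QS_eq <;> grind
  · rw [mul_assoc (_ * _), tt]
    simp only [g, qi, qj, qt, QS_mul]
    apply QS_eq <;> grind
  · rw [g2, g3, mul_assoc (_ * _), tt]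
    simp only [g, qi, qt, QS_mul]
    apply QS_eq <;> grind
  · rw [g3, g4]
    simp only [g, qi, qt, QS_mul]
    apply QS_eq <;> grind
  · rw [g4, g2]
    simp only [g, qi, qj, qt, QS_mul]
    apply QS_eq <;> grind
end

section
variable {F : Type*} [Field F] [Fintype F]

lemma card_SL2 : Nat.card (Matrix.SpecialLinearGroup (Fin 2) F)
    = Fintype.card F * (Fintype.card F ^ 2 - 1) := by
  set q := Fintype.card F with hq
  have hq1 : 1 < q := Fintype.one_lt_card
  have hGL : Nat.card (GL (Fin 2) F) = (q ^ 2 - 1) * (q ^ 2 - q) := by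
    rw [Matrix.card_GL_field]; simp [Fin.prod_univ_two, hq]
  have hker : Nat.card (Matrix.GeneralLinearGroup.det : GL (Fin 2) F →* Fˣ).ker
      = Nat.card (Matrix.SpecialLinearGroup (Fin 2) F) := by
    symm
    refine Nat.card_congr (Equiv.ofBijective
      (fun A => ⟨Matrix.SpecialLinearGroup.toGL A, ?_⟩) ⟨?_, ?_⟩)
    · rw [MonoidHom.mem_ker]; ext; simp
    · intro A B h
      exact Matrix.SpecialLinearGroup.toGL_injective (congrArg Subtype.val h)
    · rintro ⟨A, hA⟩
      rw [MonoidHom.mem_ker] at hA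
      refine ⟨⟨A.1, ?_⟩, ?_⟩
      · simpa using congrArg Units.val hA
      · apply Subtype.ext; ext; rfl
  have hr := Subgroup.card_mul_index (Matrix.GeneralLinearGroup.det : GL (Fin 2) F →* Fˣ).ker
  rw [Subgroup.index_ker, MonoidHom.range_eq_top.2 Matrix.GeneralLinearGroup.det_surjective,
    Subgroup.card_top, hker, hGL, Nat.card_units, Nat.card_eq_fintype_card (α := F),
    ← hq] at hr
  have hpos : 0 < q - 1 := by omega
  apply Nat.eq_of_mul_eq_mul_right hpos
  rw [hr, show q ^ 2 - q = q * (q - 1) by rw [Nat.mul_sub, mul_one, pow_two]]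
  ring

lemma piPart_factor (π : Set ℕ) {m : ℕ} (hm : m ≠ 0) :
    ∃ c, m = piPart π m * c ∧ (∀ r ∈ π, r.Prime → ¬ r ∣ c) := by
  classical
  refine ⟨∏ p ∈ m.primeFactors, if p ∈ π then 1 else p ^ m.factorization p, ?_, ?_⟩
  · unfold piPart
    rw [← Finset.prod_mul_distrib]
    conv_lhs => rw [← Nat.prod_factorization_pow_eq_self hm]
    rw [Finsupp.prod, Nat.support_factorization]
    apply Finset.prod_congr rfl
    intro p _
    split_ifs <;> simp
  · intro r hr hrp hd
    obtain ⟨p, hp, hd⟩ := (hrp.prime.dvd_finsetProd_iff _).1 hd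
    split_ifs at hd with h
    · exact hrp.one_lt.ne' (Nat.dvd_one.1 hd)
    · have := (Nat.prime_dvd_prime_iff_eq hrp (Nat.prime_of_mem_primeFactors hp)).1
        (hrp.dvd_of_dvd_pow hd)
      exact h (this ▸ hr)

lemma piPart_primes (π : Set ℕ) {m : ℕ} : IsPiNumber π (piPart π m) := by
  classical
  intro r hrp hd
  unfold piPart at hd
  obtain ⟨p, hp, hd⟩ := (hrp.prime.dvd_finsetProd_iff _).1 hd
  split_ifs at hd with h
  · have := (Nat.prime_dvd_prime_iff_eq hrp (Nat.prime_of_mem_primeFactors hp)).1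
        (hrp.dvd_of_dvd_pow hd)
    exact this ▸ h
  · exact absurd (Nat.dvd_one.1 hd) hrp.one_lt.ne'

lemma hall_of {π : Set ℕ} (hp : ringChar F ∉ π)
    (H : Subgroup (Matrix.SpecialLinearGroup (Fin 2) F)) (c : ℕ)
    (hc : Fintype.card F ^ 2 - 1 = Nat.card H * c) (hH : IsPiNumber π (Nat.card H))
    (hcp : ∀ r ∈ π, r.Prime → ¬ r ∣ c) : IsHallPi π H := by
  refine ⟨hH, fun r hr hrp hd => ?_⟩
  have h1 := Subgroup.card_mul_index H
  rw [card_SL2, hc] at h1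
  have hi : H.index = Fintype.card F * c := by
    apply Nat.eq_of_mul_eq_mul_left (Nat.card_pos (α := H))
    rw [h1]; ring
  rw [hi, hrp.dvd_mul] at hd
  rcases hd with hd | hd
  · obtain ⟨n, hpr, hn⟩ := FiniteField.card F (ringChar F)
    rw [hn] at hd
    have := (Nat.prime_dvd_prime_iff_eq hrp hpr).1 (hrp.dvd_of_dvd_pow hd)
    exact hp (this ▸ hr)
  · exact hcp r hr hrp hd

lemma hall_of_piPart {π σ : Set ℕ} (hp : ringChar F ∉ π) {N : ℕ} (hN : N = Fintype.card F ^ 2 - 1)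
    (hσ : {r : ℕ | r ∈ π ∧ r.Prime ∧ r ∣ N} = σ)
    (H : Subgroup (Matrix.SpecialLinearGroup (Fin 2) F))
    (hH : Nat.card H = piPart σ N) : IsHallPi π H := by
  have hq1 : 1 < Fintype.card F := Fintype.one_lt_card
  have hN0 : N ≠ 0 := by
    have : 1 < Fintype.card F ^ 2 := Nat.one_lt_pow (by norm_num) hq1
    omega
  obtain ⟨c, hc, hcp⟩ := piPart_factor σ hN0
  refine hall_of hp H c (by rw [← hN, hH]; exact hc) ?_ ?_
  · rw [hH]
    intro r hrp hd
    have := piPart_primes σ r hrp hd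
    rw [← hσ] at this
    exact this.1
  · intro r hr hrp hd
    have : r ∈ σ := by
      rw [← hσ]
      exact ⟨hr, hrp, hd.trans ⟨_, by rw [mul_comm]; exact hc⟩⟩
    exact hcp r this hrp hd

lemma exists_sum_sq (h2 : (2 : F) ≠ 0) (c : F) : ∃ a b : F, a ^ 2 + b ^ 2 = c := by
  open Polynomial in
  obtain ⟨a, b, hab⟩ := FiniteField.exists_root_sum_quadratic (f := (X ^ 2 : F[X]))
    (g := X ^ 2 - C c) (degree_X_pow 2) (degree_X_pow_sub_C (by norm_num) c) (by
      apply FiniteField.odd_card_of_char_ne_two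
      intro h
      have := ringChar.Nat.cast_ringChar (R := F)
      rw [h] at this
      exact h2 (by exact_mod_cast this))
  exact ⟨a, b, by simp at hab; linear_combination hab⟩

/-- split torus -/
def splitTorus : Fˣ →* Matrix.SpecialLinearGroup (Fin 2) F where
  toFun u := ⟨!![(u : F), 0; 0, (u : F)⁻¹], by simp [Matrix.det_fin_two]⟩
  map_one' := by
    apply Subtype.ext; ext i j; fin_cases i <;> fin_cases j <;> simp
  map_mul' u v := Subtype.ext (by
    change !![((u * v : Fˣ) : F), 0; 0, ((u * v : Fˣ) : F)⁻¹] =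
      !![(u : F), 0; 0, (u : F)⁻¹] * !![(v : F), 0; 0, (v : F)⁻¹]
    simp [mul_comm])

lemma splitTorus_val (u : Fˣ) : (splitTorus u).1 = !![(u : F), 0; 0, (u : F)⁻¹] := rfl

lemma exists_split (n : ℕ) (hn : n ∣ Fintype.card F - 1) (h2 : 2 ∣ n) :
    ∃ H : Subgroup (Matrix.SpecialLinearGroup (Fin 2) F), Nat.card H = 2 * n := by
  refine exists_dicyclic (splitTorus (F := F)) ?_ ⟨!![0, 1; -1, 0], by simp [Matrix.det_fin_two]⟩
    ?_ ?_ (-1) ?_ (by simp) n ?_ h2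
  · intro u v h
    have := congrFun (congrFun (congrArg Subtype.val h) 0) 0
    rw [splitTorus_val, splitTorus_val] at this
    exact Units.ext (by simpa using this)
  · intro u
    apply Subtype.ext
    change (splitTorus u).1 * !![0, 1; -1, 0] = !![0, 1; -1, 0] * (splitTorus u⁻¹).1
    rw [splitTorus_val, splitTorus_val]
    simp
  · rintro ⟨u, h⟩
    have := congrFun (congrFun (congrArg Subtype.val h) 0) 1
    rw [splitTorus_val] at this
    simp at this
  · apply Subtype.ext
    change (splitTorus (-1)).1 = !![0, 1; -1, 0] * !![0, 1; -1, 0]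
    rw [splitTorus_val]
    simp [inv_neg]
  · rw [Nat.card_units, Nat.card_eq_fintype_card]; exact hn

/-- F(i) -/
abbrev QK (F : Type*) [Field F] := QuadraticAlgebra F (-1 : F) 0

/-- rotation matrix -/
def rotM (z : QK F) : Matrix (Fin 2) (Fin 2) F := !![z.re, z.im; -z.im, z.re]

lemma rotM_mul (z w : QK F) : rotM (z * w) = rotM z * rotM w := by
  ext i j
  fin_cases i <;> fin_cases j <;> simp [rotM] <;> ring

lemma QK_re_one : (1 : QK F).re = 1 := rfl

lemma QK_im_one : (1 : QK F).im = 0 := rfl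

lemma rotM_one : rotM (1 : QK F) = 1 := by
  ext i j
  fin_cases i <;> fin_cases j <;> simp [rotM, QK_re_one, QK_im_one]

lemma QK_norm (z : QK F) : z.norm = z.re ^ 2 + z.im ^ 2 := by
  rw [QuadraticAlgebra.norm_def]; ring

lemma rotM_det (z : QK F) : (rotM z).det = z.norm := by
  rw [rotM, Matrix.det_fin_two_of, QK_norm]; ring

/-- norm on units -/
def normU (F : Type*) [Field F] : (QK F)ˣ →* Fˣ := Units.map QuadraticAlgebra.norm

lemma normU_ker (u : (normU F).ker) : (u : (QK F)ˣ).val.norm = 1 := by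
  have := u.2
  rw [MonoidHom.mem_ker] at this
  exact congrArg Units.val this

/-- nonsplit torus -/
def nonsplitTorus : (normU F).ker →* Matrix.SpecialLinearGroup (Fin 2) F where
  toFun u := ⟨rotM (u : (QK F)ˣ).val, by rw [rotM_det, normU_ker]⟩
  map_one' := Subtype.ext rotM_one
  map_mul' u v := Subtype.ext (rotM_mul _ _)

lemma nonsplitTorus_val (u : (normU F).ker) :
    (nonsplitTorus u).1 = rotM (u : (QK F)ˣ).val := rfl

lemma nonsplitTorus_injective : Function.Injective (nonsplitTorus (F := F)) := by
  intro u v h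
  have e0 := congrFun (congrFun (congrArg Subtype.val h) 0) 0
  have e1 := congrFun (congrFun (congrArg Subtype.val h) 0) 1
  rw [nonsplitTorus_val, nonsplitTorus_val] at e0 e1
  apply Subtype.ext; apply Units.ext
  exact QuadraticAlgebra.ext (by simpa [rotM] using e0) (by simpa [rotM] using e1)

lemma nonsplitTorus_inv (u : (normU F).ker) : (nonsplitTorus u⁻¹).1 =
    !![(u : (QK F)ˣ).val.re, -(u : (QK F)ˣ).val.im;
      (u : (QK F)ˣ).val.im, (u : (QK F)ˣ).val.re] := by
  rw [map_inv]
  change ((nonsplitTorus u).1).adjugate = _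
  rw [nonsplitTorus_val, rotM, Matrix.adjugate_fin_two]
  simp

lemma card_normU_ker (hsq : ¬ IsSquare (-1 : F)) (h2' : (2 : F) ≠ 0) :
    Nat.card (normU F).ker = Fintype.card F + 1 := by
  have hfact : Fact (∀ r : F, r ^ 2 ≠ (-1) + 0 * r) :=
    ⟨fun r hr => hsq ⟨r, by rw [← pow_two, hr]; ring⟩⟩
  have : Finite (QK F) := Finite.of_equiv _ (QuadraticAlgebra.equivProd (-1 : F) 0).symm
  have hNs : Function.Surjective (normU F) := by
    intro c
    obtain ⟨a, b, hab⟩ := exists_sum_sq h2' (c : F)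
    have hz : (⟨a, b⟩ : QK F).norm = c := by rw [QK_norm, hab]
    have hz0 : (⟨a, b⟩ : QK F) ≠ 0 := by
      intro h0
      rw [h0, QuadraticAlgebra.norm_zero] at hz
      exact c.ne_zero hz.symm
    exact ⟨Units.mk0 _ hz0, Units.ext hz⟩
  have hcK : Nat.card (QK F) = Fintype.card F ^ 2 := by
    rw [Nat.card_congr (QuadraticAlgebra.equivProd (-1 : F) 0), Nat.card_prod,
      Nat.card_eq_fintype_card, pow_two]
  have hq1 : 1 < Fintype.card F := Fintype.one_lt_card
  have hr := Subgroup.card_mul_index (normU F).ker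
  rw [Subgroup.index_ker, MonoidHom.range_eq_top.2 hNs, Subgroup.card_top, Nat.card_units,
    Nat.card_units, hcK, Nat.card_eq_fintype_card (α := F)] at hr
  apply Nat.eq_of_mul_eq_mul_right (show 0 < Fintype.card F - 1 by omega)
  rw [hr]
  have := Nat.sq_sub_sq (Fintype.card F) 1
  simpa using this

lemma exists_nonsplit (hsq : ¬ IsSquare (-1 : F)) (h2' : (2 : F) ≠ 0) (n : ℕ)
    (hn : n ∣ Fintype.card F + 1) (h2 : 2 ∣ n) :
    ∃ H : Subgroup (Matrix.SpecialLinearGroup (Fin 2) F), Nat.card H = 2 * n := by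
  have hcker := card_normU_ker hsq h2'
  have hfact : Fact (∀ r : F, r ^ 2 ≠ (-1) + 0 * r) :=
    ⟨fun r hr => hsq ⟨r, by rw [← pow_two, hr]; ring⟩⟩
  have : Finite (QK F) := Finite.of_equiv _ (QuadraticAlgebra.equivProd (-1 : F) 0).symm
  obtain ⟨a, b, hab⟩ := exists_sum_sq h2' (-1 : F)
  have hz : (-1 : (QK F)ˣ) ∈ (normU F).ker := by
    rw [MonoidHom.mem_ker]
    apply Units.ext
    change QuadraticAlgebra.norm (-1 : QK F) = 1
    rw [QuadraticAlgebra.norm_neg, QuadraticAlgebra.norm_one]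
  refine exists_dicyclic (nonsplitTorus (F := F)) nonsplitTorus_injective ⟨!![a, b; b, -a], by
      rw [Matrix.det_fin_two_of]; linear_combination -hab⟩ ?_ ?_ ⟨-1, hz⟩ ?_ ?_ n (hcker ▸ hn) h2
  · intro u
    apply Subtype.ext
    change (nonsplitTorus u).1 * !![a, b; b, -a] = !![a, b; b, -a] * (nonsplitTorus u⁻¹).1
    rw [nonsplitTorus_inv, nonsplitTorus_val, rotM]
    ext i j
    fin_cases i <;> fin_cases j <;> simp <;> ring
  · rintro ⟨u, h⟩
    have e0 := congrFun (congrFun (congrArg Subtype.val h) 0) 0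
    have e1 := congrFun (congrFun (congrArg Subtype.val h) 0) 1
    have e2 := congrFun (congrFun (congrArg Subtype.val h) 1) 0
    have e3 := congrFun (congrFun (congrArg Subtype.val h) 1) 1
    rw [nonsplitTorus_val] at e0 e1 e2 e3
    simp [rotM] at e0 e1 e2 e3
    have ha : a = 0 := by
      have : 2 * a = 0 := by linear_combination e3 - e0
      simpa [h2'] using this
    have hb : b = 0 := by
      have : 2 * b = 0 := by linear_combination -e1 - e2
      simpa [h2'] using this
    simp [ha, hb] at hab
  · apply Subtype.ext
    change rotM (-1 : QK F) = !![a, b; b, -a] * !![a, b; b, -a]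
    ext i j
    fin_cases i <;> fin_cases j <;> simp [rotM, QK_re_one, QK_im_one]
    · linear_combination -hab
    · ring
    · ring
    · linear_combination -hab
  · apply Subtype.ext
    change (-1 : (QK F)ˣ) ^ 2 = 1
    exact neg_one_sq
end

lemma case_a {F : Type*} [Field F] [Fintype F] {π : Set ℕ} (hp : ringChar F ∉ π) (h2 : 2 ∈ π)
    {a b : ℕ} (hab : a * b = Fintype.card F ^ 2 - 1) (ha : 2 ∣ a) (ha0 : a ≠ 0)
    (hb : b % 4 = 2)
    (hr2 : ∀ r, r ∣ a → r ∣ b → r ∣ 2) (hr : ∀ r ∈ π, r.Prime → r ∣ b → r ∣ a)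
    (hex : ∀ n, n ∣ a → 2 ∣ n →
      ∃ H : Subgroup (Matrix.SpecialLinearGroup (Fin 2) F), Nat.card H = 2 * n) :
    ∃ H : Subgroup (Matrix.SpecialLinearGroup (Fin 2) F), IsHallPi π H := by
  obtain ⟨c, hc, hcp⟩ := piPart_factor π ha0
  have hpp := piPart_primes π (m := a)
  generalize piPart π a = n at hc hpp
  obtain ⟨k, rfl⟩ : 2 ∣ b := by omega
  have h2n : 2 ∣ n := by
    rw [hc, Nat.prime_two.dvd_mul] at ha
    exact ha.resolve_right (hcp 2 h2 Nat.prime_two)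
  obtain ⟨H, hH⟩ := hex n ⟨c, hc⟩ h2n
  refine ⟨H, hall_of hp H (c * k) ?_ ?_ ?_⟩
  · rw [← hab, hH, hc]; ring
  · rw [hH]
    intro r hrp hd
    rcases (hrp.dvd_mul).1 hd with hd | hd
    · rwa [(Nat.prime_dvd_prime_iff_eq hrp Nat.prime_two).1 hd]
    · exact hpp r hrp hd
  · intro r hrπ hrp hd
    rcases (hrp.dvd_mul).1 hd with hd | hd
    · exact hcp r hrπ hrp hd
    · have h1 : r ∣ 2 * k := Dvd.dvd.mul_left hd 2
      have := (Nat.prime_dvd_prime_iff_eq hrp Nat.prime_two).1 (hr2 r (hr r hrπ hrp h1) h1)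
      subst this
      omega

lemma isSquare_five {F : Type*} [Field F] [Fintype F] (hF : ringChar F ≠ 2)
    (h5 : 5 ∣ Fintype.card F ^ 2 - 1) : IsSquare (5 : F) := by
  have : Fact (Nat.Prime 5) := ⟨by norm_num⟩
  have hodd := FiniteField.odd_card_of_char_ne_two hF
  have key := (FiniteField.isSquare_odd_prime_iff hF (p := 5) (by norm_num)).2
  have hq1 : 1 < Fintype.card F := Fintype.one_lt_card
  have h0 : 1 < Fintype.card F ^ 2 := Nat.one_lt_pow (by norm_num) hq1
  have hm : Fintype.card F ^ 2 % 5 = 1 := by omega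
  have hm' : Fintype.card F % 5 = 1 ∨ Fintype.card F % 5 = 4 := by
    rw [Nat.pow_mod] at hm
    have hlt : Fintype.card F % 5 < 5 := Nat.mod_lt _ (by norm_num)
    generalize Fintype.card F % 5 = m at hm hlt
    interval_cases m <;> simp_all
  have hc : ((Fintype.card F : ℕ) : ZMod 5) = ((Fintype.card F % 5 : ℕ) : ZMod 5) := by simp
  have e : (5 : F) = ((5 : ℕ) : F) := by norm_num
  rw [e]
  apply key
  intro hneg
  rw [quadraticChar_neg_one_iff_not_isSquare] at hneg
  apply hneg
  have h4 : Fintype.card F % 4 = 1 ∨ Fintype.card F % 4 = 3 := by omega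
  rw [hc]
  rcases h4 with h4 | h4
  · rw [ZMod.χ₄_nat_one_mod_four h4]
    rcases hm' with h | h <;> rw [h]
    · exact ⟨1, by rfl⟩
    · exact ⟨2, by rfl⟩
  · rw [ZMod.χ₄_nat_three_mod_four h4]
    rcases hm' with h | h <;> rw [h]
    · exact ⟨2, by rfl⟩
    · exact ⟨1, by rfl⟩

/-- Let `F` be a finite field of odd order `q` and characteristic `p`, and let
`π` be a set of primes with `2, 3 ∈ π` and `p ∉ π`. Let `ε = ±1` with
`q ≡ ε (mod 4)`. If one of the conditions (a)–(d) holds, then `SL₂(F)`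
possesses a `π`-Hall subgroup. -/
theorem stmt_14 (F : Type*) [Field F] [Fintype F]
    (q : ℕ) (hq : q = Fintype.card F) (hqodd : Odd q)
    (π : Set ℕ) (h2 : 2 ∈ π) (h3 : 3 ∈ π) (hp : ringChar F ∉ π)
    (ε : ℤ) (hε : ε = 1 ∨ ε = -1) (hqε : (q : ℤ) ≡ ε [ZMOD 4])
    (hcase :
      -- (a) every prime in π dividing q² − 1 divides q − ε
      (∀ r ∈ π, r.Prime → (r : ℤ) ∣ ((q : ℤ) ^ 2 - 1) → (r : ℤ) ∣ ((q : ℤ) - ε)) ∨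
      -- (b) primes of π dividing q² − 1 are exactly {2,3} and (q²−1)_{2,3} = 24
      ({r : ℕ | r ∈ π ∧ r.Prime ∧ r ∣ (q ^ 2 - 1)} = {2, 3} ∧
        piPart {2, 3} (q ^ 2 - 1) = 24) ∨
      -- (c) primes of π dividing q² − 1 are exactly {2,3} and (q²−1)_{2,3} = 48
      ({r : ℕ | r ∈ π ∧ r.Prime ∧ r ∣ (q ^ 2 - 1)} = {2, 3} ∧
        piPart {2, 3} (q ^ 2 - 1) = 48) ∨
      -- (d) primes of π dividing q² − 1 are exactly {2,3,5} and (q²−1)_{2,3,5} = 120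
      ({r : ℕ | r ∈ π ∧ r.Prime ∧ r ∣ (q ^ 2 - 1)} = {2, 3, 5} ∧
        piPart {2, 3, 5} (q ^ 2 - 1) = 120)) :
    ∃ H : Subgroup (Matrix.SpecialLinearGroup (Fin 2) F), IsHallPi π H := by
  subst hq
  have hr2 : ringChar F ≠ 2 := fun h => hp (h ▸ h2)
  have h2F : (2 : F) ≠ 0 := Ring.two_ne_zero hr2
  have hq1 : 1 < Fintype.card F := Fintype.one_lt_card
  obtain ⟨x, y, hxy⟩ := exists_sum_sq h2F (-1 : F)
  rcases hcase with h | ⟨hσ, hN⟩ | ⟨hσ, hN⟩ | ⟨hσ, hN⟩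
  · rcases hε with rfl | rfl
    · have hmod : Fintype.card F % 4 = 1 := by
        have := hqε; unfold Int.ModEq at this; omega
      refine case_a hp h2 (a := Fintype.card F - 1) (b := Fintype.card F + 1) ?_ (by omega)
        (by omega) (by omega) (fun r hr1 hr2 => ?_) (fun r hr hrp hd => ?_)
        (fun n hn hn2 => exists_split n hn hn2)
      · have := Nat.sq_sub_sq (Fintype.card F) 1
        rw [mul_comm]; simpa using this.symm
      · have := Nat.dvd_sub hr2 hr1
        rwa [show Fintype.card F + 1 - (Fintype.card F - 1) = 2 by omega] at this
      · have := h r hr hrp (by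
          obtain ⟨k, hk⟩ := hd
          refine ⟨((Fintype.card F - 1 : ℕ) : ℤ) * k, ?_⟩
          have hk' : (Fintype.card F : ℤ) + 1 = r * k := by exact_mod_cast hk
          rw [Nat.cast_sub hq1.le]
          push_cast
          linear_combination ((Fintype.card F : ℤ) - 1) * hk')
        rw [← Int.natCast_dvd_natCast, Nat.cast_sub hq1.le]
        exact_mod_cast this
    · have hmod : Fintype.card F % 4 = 3 := by
        have := hqε; unfold Int.ModEq at this; omega
      have hsq : ¬ IsSquare (-1 : F) := by
        rw [FiniteField.isSquare_neg_one_iff]; omega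
      refine case_a hp h2 (a := Fintype.card F + 1) (b := Fintype.card F - 1) ?_ (by omega)
        (by omega) (by omega) (fun r hr1 hr2 => ?_) (fun r hr hrp hd => ?_)
        (fun n hn hn2 => exists_nonsplit hsq h2F n hn hn2)
      · have := Nat.sq_sub_sq (Fintype.card F) 1
        simpa using this.symm
      · have := Nat.dvd_sub hr1 hr2
        rwa [show Fintype.card F + 1 - (Fintype.card F - 1) = 2 by omega] at this
      · have := h r hr hrp (by
          obtain ⟨k, hk⟩ := hd
          refine ⟨((Fintype.card F : ℤ) + 1) * k, ?_⟩
          have hk' : (Fintype.card F : ℤ) - 1 = r * k := by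
            have : ((Fintype.card F - 1 : ℕ) : ℤ) = r * k := by exact_mod_cast hk
            rwa [Nat.cast_sub hq1.le, Nat.cast_one] at this
          linear_combination ((Fintype.card F : ℤ) + 1) * hk')
        rw [sub_neg_eq_add] at this
        exact_mod_cast this
  · obtain ⟨H, hH⟩ := exists_24 hxy h2F
    exact ⟨H, hall_of_piPart hp rfl hσ H (by rw [hH, hN])⟩
  · have hN0 : Fintype.card F ^ 2 - 1 ≠ 0 := by
      have : 1 < Fintype.card F ^ 2 := Nat.one_lt_pow (by norm_num) hq1
      omega
    have hs : IsSquare (2 : F) := by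
      rw [FiniteField.isSquare_two_iff]
      obtain ⟨c, hc, -⟩ := piPart_factor {2, 3} hN0
      rw [hN] at hc
      have h16 : (Fintype.card F ^ 2) % 16 = 1 := by omega
      rw [Nat.pow_mod] at h16
      have hlt : Fintype.card F % 16 < 16 := Nat.mod_lt _ (by norm_num)
      have h8 : Fintype.card F % 16 % 8 = Fintype.card F % 8 := Nat.mod_mod_of_dvd _ (by norm_num)
      rw [← h8]
      generalize Fintype.card F % 16 = m at h16 hlt
      interval_cases m <;> simp_all
    obtain ⟨H, hH⟩ := exists_48 hxy h2F hs
    exact ⟨H, hall_of_piPart hp rfl hσ H (by rw [hH, hN])⟩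
  · have h5 : 5 ∣ Fintype.card F ^ 2 - 1 := by
      have : 5 ∈ ({2, 3, 5} : Set ℕ) := by simp
      rw [← hσ] at this
      exact this.2.2
    obtain ⟨H, hH⟩ := exists_120 hxy h2F (isSquare_five hr2 h5)
    exact ⟨H, hall_of_piPart hp rfl hσ H (by rw [hH, hN])⟩
end
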